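/- For every integer n ≥ 1, the sum over all type-B permutation tableaux T of size n of U_n(T), the number of unrestricted rows of T, equals H_n·|B_n|, where H_n = 1 + 1/2 + ... + 1/n is the n-th harmonic number; equivalently, the expected number of unrestricted rows of a uniformly random type-B permutation tableau of size n is H_n. -/

import Mathlib

/-- A type-B permutation tableau of size `n`, encoded via its border steps and filling.

Border steps are indexed by `Fin n` (index `i` is the `(i+1)`-th step from the
northeast corner); `west i = true` means the `(i+1)`-th step is a west step
(giving a column) and `west i = false` means it is a south step (giving a row
of the original, unshifted diagram).

Rows of the shifted diagram are also indexed by `Fin n`: a south step `r` indexes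
the corresponding original row, and a west step `r` indexes the inserted diagonal
row whose diagonal cell lies in the column of `r`.  The cell in row `r` and the
column of a west step `c` exists iff (`r` is south and `r < c`) or (`r` is west
and `r ≤ c`); in particular the diagonal cell of the column of `c` is `(c, c)`.
Columns are ordered left-to-right by decreasing step index, rows top-to-bottom as:
diagonal rows by decreasing step index, then original rows by increasing step index.

`filling r c = true` means the cell `(r, c)` contains a 1; `filling` is `false`
outside the cells of the diagram (field `support`).  The fields `col_one`,
`no_bad_zero` and `diag_zero` are the three defining conditions of a type-B
permutation tableau. -/
structure TypeBTableau (n : ℕ) where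
  west : Fin n → Bool
  filling : Fin n → Fin n → Bool
  support : ∀ r c : Fin n, filling r c = true →
    west c = true ∧ ((west r = false ∧ (r : ℕ) < (c : ℕ)) ∨ (west r = true ∧ (r : ℕ) ≤ (c : ℕ)))
  col_one : ∀ c : Fin n, west c = true → ∃ r : Fin n, filling r c = true
  no_bad_zero : ∀ r c : Fin n,
    (west c = true ∧ ((west r = false ∧ (r : ℕ) < (c : ℕ)) ∨ (west r = true ∧ (r : ℕ) ≤ (c : ℕ)))) →
    filling r c = false →
    ¬((∃ r' : Fin n,
        ((west r' = true ∧ west r = false) ∨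
         (west r' = true ∧ west r = true ∧ (r : ℕ) < (r' : ℕ)) ∨
         (west r' = false ∧ west r = false ∧ (r' : ℕ) < (r : ℕ))) ∧
        filling r' c = true) ∧
      (∃ c' : Fin n, (c : ℕ) < (c' : ℕ) ∧ filling r c' = true))
  diag_zero : ∀ j : Fin n, west j = true → filling j j = false →
    ∀ c : Fin n, filling j c = false

namespace TypeBTableau

noncomputable instance instFintype {n : ℕ} : Fintype (TypeBTableau n) :=
  Fintype.ofInjective (fun T => (T.west, T.filling)) (by
    rintro ⟨w1, f1, _, _, _, _⟩ ⟨w2, f2, _, _, _, _⟩ h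
    simp only [Prod.mk.injEq] at h
    obtain ⟨h1, h2⟩ := h
    subst h1; subst h2; rfl)

end TypeBTableau

namespace TypeBTableau

/-- `T.IsCell r c` : the shifted Ferrers diagram of `T` has a cell in row `r` and
in the column of the west step `c`. -/
def IsCell {n : ℕ} (T : TypeBTableau n) (r c : Fin n) : Prop :=
  T.west c = true ∧
    ((T.west r = false ∧ (r : ℕ) < (c : ℕ)) ∨ (T.west r = true ∧ (r : ℕ) ≤ (c : ℕ)))

/-- `T.Above r' r` : row `r'` lies strictly above row `r` in the shifted diagram
(diagonal rows come first, ordered by decreasing step index, followed by the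
original rows ordered by increasing step index). -/
def Above {n : ℕ} (T : TypeBTableau n) (r' r : Fin n) : Prop :=
  (T.west r' = true ∧ T.west r = false) ∨
  (T.west r' = true ∧ T.west r = true ∧ (r : ℕ) < (r' : ℕ)) ∨
  (T.west r' = false ∧ T.west r = false ∧ (r' : ℕ) < (r : ℕ))

/-- The cell `(r, c)` is a restricted 0: it contains a 0 and either has a 1 above
it in its column, or is a diagonal cell. -/
def RestrictedZero {n : ℕ} (T : TypeBTableau n) (r c : Fin n) : Prop :=
  T.IsCell r c ∧ T.filling r c = false ∧
    ((∃ r' : Fin n, T.Above r' r ∧ T.IsCell r' c ∧ T.filling r' c = true) ∨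
      (T.west r = true ∧ r = c))

/-- Row `r` of the shifted diagram is unrestricted: it contains no restricted 0. -/
def Unrestricted {n : ℕ} (T : TypeBTableau n) (r : Fin n) : Prop :=
  ∀ c : Fin n, ¬ T.RestrictedZero r c

instance {n : ℕ} (T : TypeBTableau n) (r c : Fin n) : Decidable (T.RestrictedZero r c) := by
  unfold RestrictedZero IsCell Above; infer_instance

instance {n : ℕ} (T : TypeBTableau n) (r : Fin n) : Decidable (T.Unrestricted r) := by
  unfold Unrestricted; infer_instance

/-- `U_n(T)`, the number of unrestricted rows of `T`. -/
def numUnrestricted {n : ℕ} (T : TypeBTableau n) : ℕ :=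
  (Finset.univ.filter (fun r : Fin n => T.Unrestricted r)).card

end TypeBTableau

open Finset

namespace TypeBTableau

def G {ι : Type*} [DecidableEq ι] (key : ι → ℤ) (A S : Finset ι) : ℕ :=
  (A.filter (fun r => r ∈ S ∨ ∀ r' ∈ S, ¬ key r' < key r)).card + (if S = ∅ then 1 else 0)

lemma sum_G {ι : Type*} [DecidableEq ι] (key : ι → ℤ) (hk : Function.Injective key)
    (x : ℝ) (A : Finset ι) :
    ∑ S ∈ A.powerset, x ^ G key A S = x * (1 + x) ^ A.card := by
  induction A using Finset.induction_on_max_value key with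
  | empty => simp [G]
  | insert a s ha hmax ih =>
    rw [Finset.sum_powerset_insert ha, Finset.card_insert_of_notMem ha, pow_succ, ← mul_assoc, ← ih,
      Finset.sum_mul, ← Finset.sum_add_distrib]
    refine Finset.sum_congr rfl fun S hS => ?_
    rw [Finset.mem_powerset] at hS
    have haS : a ∉ S := fun h => ha (hS h)
    have hlt : ∀ y ∈ s, key y < key a := fun y hy =>
      lt_of_le_of_ne (hmax y hy) (fun h => ha (hk h ▸ hy))
    have e2 : (s.filter (fun r => r ∈ insert a S ∨ ∀ r' ∈ insert a S, ¬ key r' < key r)) =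
        s.filter (fun r => r ∈ S ∨ ∀ r' ∈ S, ¬ key r' < key r) := by
      refine Finset.filter_congr fun r hr => ?_
      have h1 : r ≠ a := fun h => ha (h ▸ hr)
      have h2 := hlt r hr
      simp only [Finset.mem_insert, h1, false_or, forall_eq_or_imp]
      constructor
      · rintro (h | h)
        · exact Or.inl h
        · exact Or.inr h.2
      · rintro (h | h)
        · exact Or.inl h
        · exact Or.inr ⟨by omega, h⟩
    unfold G
    rw [Finset.filter_insert, Finset.filter_insert, e2]
    rw [if_pos (Or.inl (Finset.mem_insert_self a S)),
      Finset.card_insert_of_notMem (by simp [ha]), if_neg (Finset.insert_ne_empty a S)]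
    by_cases hE : S = ∅
    · subst hE
      rw [if_pos (by simp), Finset.card_insert_of_notMem (by simp [ha])]
      simp only [if_true]
      ring
    · obtain ⟨y, hy⟩ := Finset.nonempty_iff_ne_empty.mpr hE
      rw [if_neg, if_neg hE]
      · ring
      · rintro (h | h)
        · exact haS h
        · exact h y hy (hlt y (hS hy))

def key {n : ℕ} (T : TypeBTableau n) (r : Fin n) : ℤ :=
  if T.west r = true then -(r : ℤ) - 1 else r

lemma key_inj {n : ℕ} (T : TypeBTableau n) : Function.Injective T.key := by
  intro a b h
  unfold key at h
  ext
  split_ifs at h <;> omega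

lemma above_iff {n : ℕ} (T : TypeBTableau n) (a b : Fin n) :
    T.Above a b ↔ T.key a < T.key b := by
  unfold Above key
  cases ha : T.west a <;> cases hb : T.west b <;> simp <;> omega

def unres {n : ℕ} (T : TypeBTableau n) : Finset (Fin n) :=
  Finset.univ.filter (fun r => T.Unrestricted r)

lemma ext' {n : ℕ} {T T' : TypeBTableau n} (h1 : ∀ i, T.west i = T'.west i)
    (h2 : ∀ i j, T.filling i j = T'.filling i j) : T = T' := by
  obtain ⟨w1, f1, _, _, _, _⟩ := T
  obtain ⟨w2, f2, _, _, _, _⟩ := T'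
  obtain rfl : w1 = w2 := funext h1
  obtain rfl : f1 = f2 := funext fun i => funext (h2 i)
  rfl

lemma last_row {n : ℕ} (T : TypeBTableau (n+1)) (c : Fin n) :
    T.filling (Fin.last n) c.castSucc = false := by
  by_contra h
  have := T.support _ _ (by simpa using h)
  simp at this
  omega

def restr {n : ℕ} (T : TypeBTableau (n+1)) : TypeBTableau n where
  west i := T.west i.castSucc
  filling i j := T.filling i.castSucc j.castSucc
  support r c h := by simpa using T.support _ _ h
  col_one c h := by
    obtain ⟨r, hr⟩ := T.col_one _ h
    induction r using Fin.lastCases with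
    | last => simp [last_row] at hr
    | cast r => exact ⟨r, hr⟩
  no_bad_zero r c h1 h2 := by
    rintro ⟨⟨r', h3⟩, ⟨c', h4⟩⟩
    exact T.no_bad_zero r.castSucc c.castSucc (by simpa using h1) h2
      ⟨⟨r'.castSucc, by simpa using h3⟩, ⟨c'.castSucc, by simpa using h4⟩⟩
  diag_zero j h1 h2 c := T.diag_zero _ h1 h2 _

def lcol {n : ℕ} (T : TypeBTableau (n+1)) : Finset (Fin n) :=
  Finset.univ.filter (fun r => T.filling r.castSucc (Fin.last n) = true)

lemma mem_lcol {n : ℕ} (T : TypeBTableau (n+1)) (r : Fin n) :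
    r ∈ T.lcol ↔ T.filling r.castSucc (Fin.last n) = true := by simp [lcol]

lemma lcol_sub {n : ℕ} (T : TypeBTableau (n+1)) : T.lcol ⊆ T.restr.unres := by
  intro r hr
  rw [mem_lcol] at hr
  simp only [unres, Finset.mem_filter, Finset.mem_univ, true_and]
  rintro c ⟨h1, h2, ⟨r', h3, -, h4⟩ | ⟨h3, rfl⟩⟩
  · refine T.no_bad_zero r.castSucc c.castSucc h1 h2
      ⟨⟨r'.castSucc, h3, h4⟩, ⟨Fin.last n, by simp, hr⟩⟩
  · have := T.diag_zero _ h3 h2 (Fin.last n)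
    simp [hr] at this

lemma west_last {n : ℕ} (T : TypeBTableau (n+1)) :
    T.west (Fin.last n) = true ↔ (T.filling (Fin.last n) (Fin.last n) = true ∨ T.lcol ≠ ∅) := by
  constructor
  · intro h
    obtain ⟨r, hr⟩ := T.col_one _ h
    induction r using Fin.lastCases with
    | last => exact Or.inl hr
    | cast r =>
      right
      exact Finset.ne_empty_of_mem ((mem_lcol T r).2 hr)
  · rintro (h | h)
    · exact (T.support _ _ h).1
    · obtain ⟨r, hr⟩ := Finset.nonempty_iff_ne_empty.mpr h
      exact (T.support _ _ ((mem_lcol T r).1 hr)).1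

lemma unres_last {n : ℕ} (T : TypeBTableau (n+1)) :
    T.Unrestricted (Fin.last n) ↔
      (T.filling (Fin.last n) (Fin.last n) = true ∨ T.lcol = ∅) := by
  have hw := west_last T
  constructor
  · intro h
    by_contra hc
    push Not at hc
    have hw' := hw.2 (Or.inr hc.2.ne_empty)
    exact h (Fin.last n) ⟨⟨hw', Or.inr ⟨hw', le_rfl⟩⟩, by simpa using hc.1, Or.inr ⟨hw', rfl⟩⟩
  · intro h c hc
    obtain ⟨⟨h1, h1'⟩, h2, h3⟩ := hc
    have hcl : c = Fin.last n := by
      ext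
      have := c.2
      simp at h1' ⊢
      omega
    subst hcl
    rw [h2] at h hw
    simp only [Bool.false_eq_true, false_or] at h hw
    exact hw.1 h1 h

lemma unres_cast {n : ℕ} (T : TypeBTableau (n+1)) (r : Fin n) :
    T.Unrestricted r.castSucc ↔ (T.restr.Unrestricted r ∧
      (r ∈ T.lcol ∨ (T.filling (Fin.last n) (Fin.last n) = false ∧
        ∀ r' ∈ T.lcol, ¬ T.restr.key r' < T.restr.key r))) := by
  have hw := west_last T
  have hcell : T.west (Fin.last n) = true → ∀ r : Fin (n+1), T.IsCell r (Fin.last n) := by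
    intro h r
    refine ⟨h, ?_⟩
    induction r using Fin.lastCases with
    | last => exact Or.inr ⟨h, le_rfl⟩
    | cast r => cases h : T.west r.castSucc <;> simp <;> omega
  constructor
  · intro h
    refine ⟨?_, ?_⟩
    · rintro c ⟨h1, h2, h3⟩
      refine h c.castSucc ⟨h1, h2, ?_⟩
      rcases h3 with ⟨r', h3, h4, h5⟩ | ⟨h3, rfl⟩
      · exact Or.inl ⟨r'.castSucc, h3, h4, h5⟩
      · exact Or.inr ⟨h3, rfl⟩
    · by_contra hc
      push Not at hc
      obtain ⟨hc1, hc2⟩ := hc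
      rw [mem_lcol] at hc1
      by_cases hb : T.filling (Fin.last n) (Fin.last n) = true
      · have hw' := hw.2 (Or.inl hb)
        refine h (Fin.last n) ⟨hcell hw' _, by simpa using hc1, Or.inl ⟨Fin.last n, ?_, hcell hw' _, hb⟩⟩
        unfold Above
        cases T.west r.castSucc <;> simp [hw']
      · obtain ⟨r', h1, h2⟩ := hc2 (by simpa using hb)
        have hw' := hw.2 (Or.inr (Finset.ne_empty_of_mem h1))
        rw [← above_iff] at h2
        exact h (Fin.last n) ⟨hcell hw' _, by simpa using hc1,
          Or.inl ⟨r'.castSucc, h2, hcell hw' _, (mem_lcol T r').1 h1⟩⟩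
  · rintro ⟨h1, h2⟩ c ⟨h3, h4, h5⟩
    induction c using Fin.lastCases with
    | last =>
      rw [mem_lcol, h4] at h2
      simp only [Bool.false_eq_true, false_or] at h2
      rcases h5 with ⟨r', h5, h6, h7⟩ | ⟨h5, h6⟩
      · induction r' using Fin.lastCases with
        | last => simp [h7] at h2
        | cast r' =>
          exact h2.2 r' ((mem_lcol T r').2 h7) ((above_iff _ _ _).1 h5)
      · have := congrArg Fin.val h6
        simp at this
        omega
    | cast c =>
      refine h1 c ⟨h3, h4, ?_⟩
      rcases h5 with ⟨r', h5, h6, h7⟩ | ⟨h5, h6⟩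
      · induction r' using Fin.lastCases with
        | last => simp [last_row] at h7
        | cast r' => exact Or.inl ⟨r', h5, h6, h7⟩
      · exact Or.inr ⟨h5, by simpa using h6⟩

lemma num_eq {n : ℕ} (T : TypeBTableau (n+1)) :
    T.numUnrestricted = if T.filling (Fin.last n) (Fin.last n) = true then T.lcol.card + 1
      else G T.restr.key T.restr.unres T.lcol := by
  have h : T.numUnrestricted = (Finset.univ.filter fun r : Fin n => T.Unrestricted r.castSucc).card
      + if T.Unrestricted (Fin.last n) then 1 else 0 := by
    unfold numUnrestricted
    rw [Finset.card_filter, Fin.sum_univ_castSucc, Finset.card_filter]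
  rw [h]
  have hs := lcol_sub T
  split_ifs with h1 h2 h2
  · congr 2
    ext r
    simp only [Finset.mem_filter, Finset.mem_univ, true_and, unres_cast, h2]
    constructor
    · rintro ⟨_, h | h⟩
      · exact h
      · simp at h
    · intro h
      exact ⟨by simpa [unres] using hs h, Or.inl h⟩
  · have : T.lcol = ∅ := ((unres_last T).1 h1).resolve_left h2
    unfold G
    rw [if_pos this]
    congr 2
    ext r
    simp [unres_cast, h2, unres]
  · exact absurd ((unres_last T).2 (Or.inl h2)) h1
  · have : T.lcol ≠ ∅ := fun h => h1 ((unres_last T).2 (Or.inr h))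
    unfold G
    rw [if_neg this]
    congr 2
    ext r
    simp [unres_cast, h2, unres]

def xfill {n : ℕ} (T : TypeBTableau n) (b : Bool) (S : Finset (Fin n)) (r c : Fin (n+1)) : Bool :=
  Fin.lastCases (motive := fun _ => Bool)
    (Fin.lastCases (motive := fun _ => Bool) b (fun r => decide (r ∈ S)) r)
    (fun c => Fin.lastCases (motive := fun _ => Bool) false (fun r => T.filling r c) r) c

def xwest {n : ℕ} (T : TypeBTableau n) (b : Bool) (S : Finset (Fin n)) (c : Fin (n+1)) : Bool :=
  Fin.lastCases (motive := fun _ => Bool) (b || decide (S ≠ ∅)) T.west c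

section
variable {n : ℕ} (T : TypeBTableau n) (b : Bool) (S : Finset (Fin n)) (r c : Fin n)
@[simp] lemma xfill_ll : xfill T b S (Fin.last n) (Fin.last n) = b := by simp [xfill]
@[simp] lemma xfill_cl : xfill T b S r.castSucc (Fin.last n) = decide (r ∈ S) := by simp [xfill]
@[simp] lemma xfill_lc : xfill T b S (Fin.last n) c.castSucc = false := by simp [xfill]
@[simp] lemma xfill_cc : xfill T b S r.castSucc c.castSucc = T.filling r c := by simp [xfill]
@[simp] lemma xwest_l : xwest T b S (Fin.last n) = (b || decide (S ≠ ∅)) := by simp [xwest]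
@[simp] lemma xwest_c : xwest T b S c.castSucc = T.west c := by simp [xwest]
end

def extend {n : ℕ} (T : TypeBTableau n) (b : Bool) (S : Finset (Fin n)) (hS : S ⊆ T.unres) :
    TypeBTableau (n+1) where
  west := xwest T b S
  filling := xfill T b S
  support r c h := by
    induction c using Fin.lastCases with
    | last =>
      induction r using Fin.lastCases with
      | last => simp at h; simp [h]
      | cast r =>
        simp at h
        have := Finset.ne_empty_of_mem h
        cases hw : T.west r <;> simp [this, hw] <;> omega
    | cast c =>
      induction r using Fin.lastCases with
      | last => simp at h
      | cast r =>
        simp at h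
        simpa using T.support _ _ h
  col_one c h := by
    induction c using Fin.lastCases with
    | last =>
      cases b with
      | true => exact ⟨Fin.last n, by simp⟩
      | false =>
        simp at h
        obtain ⟨y, hy⟩ := Finset.nonempty_iff_ne_empty.mpr h
        exact ⟨y.castSucc, by simpa using hy⟩
    | cast c =>
      simp at h
      obtain ⟨y, hy⟩ := T.col_one c h
      exact ⟨y.castSucc, by simpa using hy⟩
  no_bad_zero r c h1 h2 := by
    rintro ⟨⟨r', h3, h4⟩, ⟨c', h5, h6⟩⟩
    induction c using Fin.lastCases with
    | last => 
      have := c'.2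
      simp at h5
      omega
    | cast c =>
      induction r' using Fin.lastCases with
      | last => simp at h4
      | cast r' =>
      induction r using Fin.lastCases with
      | last =>
        simp at h1
        omega
      | cast r =>
      simp at h1 h2 h3 h4
      induction c' using Fin.lastCases with
      | last =>
        simp at h6
        have := hS h6
        simp only [unres, Finset.mem_filter, Finset.mem_univ, true_and] at this
        exact this c ⟨by simpa [IsCell] using h1, h2, Or.inl ⟨r', by simpa [Above] using h3,
          T.support _ _ h4, h4⟩⟩
      | cast c' =>
        simp at h5 h6
        exact T.no_bad_zero r c (by simpa using h1) h2 ⟨⟨r', by simpa using h3, h4⟩,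
          ⟨c', by simpa using h5, h6⟩⟩
  diag_zero j h1 h2 c := by
    induction j using Fin.lastCases with
    | last =>
      induction c using Fin.lastCases with
      | last => exact h2
      | cast c => simp
    | cast j =>
      simp at h1 h2
      induction c using Fin.lastCases with
      | last =>
        simp
        intro h
        have := hS h
        simp only [unres, Finset.mem_filter, Finset.mem_univ, true_and] at this
        exact this j ⟨⟨h1, Or.inr ⟨h1, le_rfl⟩⟩, h2, Or.inr ⟨h1, rfl⟩⟩
      | cast c => simpa using T.diag_zero j h1 h2 c

lemma sum_rec (n : ℕ) (x : ℝ) :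
    ∑ T : TypeBTableau (n+1), x ^ T.numUnrestricted =
      ∑ T : TypeBTableau n, 2 * x * (1 + x) ^ T.numUnrestricted := by
  have h : ∀ T : TypeBTableau n, 2 * x * (1 + x) ^ T.numUnrestricted =
      ∑ p ∈ (Finset.univ : Finset Bool) ×ˢ T.unres.powerset,
        x ^ (if p.1 = true then p.2.card + 1 else G T.key T.unres p.2) := by
    intro T
    rw [Finset.sum_product]
    have h1 := Finset.sum_pow_mul_eq_add_pow x 1 T.unres
    simp only [one_pow, mul_one] at h1
    simp only [Fintype.univ_bool, Finset.mem_singleton, Bool.true_eq_false, not_false_eq_true,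
      Finset.sum_insert, Finset.sum_singleton, if_true, Bool.false_eq_true, if_false, pow_succ]
    rw [sum_G _ T.key_inj, ← Finset.sum_mul, h1]
    unfold numUnrestricted unres
    ring
  simp_rw [h]
  rw [Finset.sum_sigma']
  refine Finset.sum_bij
    (fun T _ => ⟨T.restr, (T.filling (Fin.last n) (Fin.last n), T.lcol)⟩) ?_ ?_ ?_ ?_
  · intro T _
    simpa using lcol_sub T
  · intro T _ T' _ h
    simp only [Sigma.mk.injEq, heq_eq_eq, Prod.mk.injEq] at h
    obtain ⟨h1, h2, h3⟩ := h
    have hf : ∀ r, r ∈ T.lcol ↔ r ∈ T'.lcol := fun r => by rw [h3]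
    simp only [mem_lcol] at hf
    apply ext'
    · intro i
      induction i using Fin.lastCases with
      | last => rw [Bool.eq_iff_iff, west_last, west_last, h2, h3]
      | cast i => exact congrFun (congrArg TypeBTableau.west h1) i
    · intro i j
      induction j using Fin.lastCases with
      | last =>
        induction i using Fin.lastCases with
        | last => exact h2
        | cast i => rw [Bool.eq_iff_iff]; exact hf i
      | cast j =>
        induction i using Fin.lastCases with
        | last => rw [last_row, last_row]
        | cast i => exact congrFun (congrFun (congrArg TypeBTableau.filling h1) i) j
  · rintro ⟨T, b, S⟩ hS
    have hS' : S ⊆ T.unres := by simpa using hS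
    refine ⟨extend T b S hS', Finset.mem_univ _, ?_⟩
    have e1 : (extend T b S hS').restr = T := by
      apply ext'
      · intro i
        simp [restr, extend]
      · intro i j
        simp [restr, extend]
    have e2 : (extend T b S hS').lcol = S := by
      ext i
      simp [lcol, extend]
    have e3 : (extend T b S hS').filling (Fin.last n) (Fin.last n) = b := by simp [extend]
    rw [e1, e2, e3]
  · intro T _
    simp only
    rw [num_eq]

lemma gen (n : ℕ) (x : ℝ) : ∑ T : TypeBTableau n, x ^ T.numUnrestricted =
    ∏ i ∈ Finset.range n, (2 * (x + i)) := by
  induction n generalizing x with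
  | zero =>
    have hc : Fintype.card (TypeBTableau 0) = 1 := by
      rw [Fintype.card_eq_one_iff]
      refine ⟨⟨fun i => i.elim0, fun i => i.elim0, fun i => i.elim0, fun i => i.elim0,
        fun i => i.elim0, fun i => i.elim0⟩, fun T => ext' (fun i => i.elim0) (fun i => i.elim0)⟩
    simp [numUnrestricted, hc]
  | succ n ih =>
    rw [sum_rec, ← Finset.mul_sum, ih, Finset.prod_range_succ']
    push_cast
    rw [mul_comm, add_zero]
    congr 1
    refine Finset.prod_congr rfl fun i _ => ?_
    ring

end TypeBTableau

/-- The total number of unrestricted rows over all type-B permutation tableaux of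
size `n` equals `H_n · |B_n|`, where `H_n` is the `n`-th harmonic number; i.e. the
expected number of unrestricted rows of a uniformly random type-B permutation
tableau of size `n` is `H_n`. -/
theorem expected_unrestricted_rows (n : ℕ) (hn : 1 ≤ n) :
    (∑ T : TypeBTableau n, (T.numUnrestricted : ℝ)) =
      (∑ i ∈ Finset.range n, (1 : ℝ) / ((i : ℝ) + 1)) * (Fintype.card (TypeBTableau n) : ℝ) := by
  have h1 : HasDerivAt (fun x : ℝ => ∑ T : TypeBTableau n, x ^ T.numUnrestricted)
      (∑ T : TypeBTableau n, (T.numUnrestricted : ℝ)) 1 := by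
    have := HasDerivAt.fun_sum (u := (Finset.univ : Finset (TypeBTableau n)))
      (A := fun T x => x ^ T.numUnrestricted) (x := (1 : ℝ))
      (fun T _ => hasDerivAt_pow T.numUnrestricted (1 : ℝ))
    simpa using this
  have hc : (Fintype.card (TypeBTableau n) : ℝ) = ∏ i ∈ Finset.range n, (2 * ((1 : ℝ) + i)) := by
    rw [← TypeBTableau.gen]
    simp
  have h2 : HasDerivAt (fun x : ℝ => ∏ i ∈ Finset.range n, (2 * (x + i)))
      ((∑ i ∈ Finset.range n, (1 : ℝ) / ((i : ℝ) + 1)) *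
        ∏ i ∈ Finset.range n, (2 * ((1 : ℝ) + i))) 1 := by
    clear h1 hc hn
    induction n with
    | zero => simpa using hasDerivAt_const (1 : ℝ) (1 : ℝ)
    | succ n ih =>
      simp only [Finset.prod_range_succ, Finset.sum_range_succ]
      have h3 : HasDerivAt (fun x : ℝ => 2 * (x + n)) 2 1 := by
        simpa using ((hasDerivAt_id (1 : ℝ)).add_const (n : ℝ)).const_mul 2
      refine (ih.fun_mul h3).congr_deriv ?_
      have : (n : ℝ) + 1 ≠ 0 := by positivity
      have h4 : 1 / ((n : ℝ) + 1) * (2 * (1 + n)) = 2 := by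
        field_simp
        ring
      linear_combination -(∏ i ∈ Finset.range n, (2 * ((1 : ℝ) + (i : ℝ))) : ℝ) * h4
  rw [hc]
  have h3 := funext (TypeBTableau.gen n)
  rw [h3] at h1
  exact h1.unique h2
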